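/- Let x⁽⁰⁾ ∈ Kⁿ have pairwise distinct components and satisfy E_f(x⁽⁰⁾) = max_i |W_i(x⁽⁰⁾)|/d_i(x⁽⁰⁾) ≤ 4/(9n) (i.e. the case p = ∞, so q = 1, a = n−1, b = 2). Then f has n simple zeros in K, the Prešić-Tanabe (Dochev-Byrnev) iteration x⁽ᵏ⁺¹⁾ = 𝒯(x⁽ᵏ⁾) is well defined for all k ≥ 0 and converges to a root vector ξ of f, and for every k ≥ 0 the closed disks with centers x_i⁽ᵏ⁾ and radii r_i⁽ᵏ⁾ = (γ(E_f(x⁽ᵏ⁾))/(1 − β(E_f(x⁽ᵏ⁾))))·|W_i(x⁽ᵏ⁾)|, where γ(t) = 1 + (n−1)t and β(t) = ((n−1)t²(1 + (n−1)t)(n + (n−1)t) / ((1 − (n−1)t)(1 − t − (n−1)t²))) · (1 + t(1 + (n−1)t)/(1 − 2t − 2(n−1)t²))^{n−1}, are mutually disjoint and each contains exactly one zero of f. (Corollary 4.6) -/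

import Mathlib

open Finset Polynomial Filter

noncomputable section

/-- The Weierstrass correction `W_i(x) = f(x_i)/(C₀ ∏_{j≠i}(x_i − x_j))`. -/
def Wc {n : ℕ} {K : Type*} [NormedField K] (f : Polynomial K) (x : Fin n → K) (i : Fin n) : K :=
  eval (x i) f / (f.leadingCoeff * ∏ j ∈ univ.erase i, (x i - x j))

/-- `dmin x i = min_{j ≠ i} ‖x i - x j‖`. -/
def dmin {n : ℕ} {K : Type*} [NormedField K] (x : Fin n → K) (i : Fin n) : ℝ :=
  if h : (univ.erase i).Nonempty then (univ.erase i).inf' h fun j => ‖x i - x j‖ else 0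

/-- `E_f(x)` : the ℓ^p norm of the vector `(‖W_i(x)‖ / d_i(x))_i`. -/
def Ef {n : ℕ} {K : Type*} [NormedField K] (p : ENNReal) (f : Polynomial K)
    (x : Fin n → K) : ℝ :=
  ‖(WithLp.equiv p (Fin n → ℝ)).symm (fun i => ‖Wc f x i‖ / dmin x i)‖

/-- `σ_i(x) = Σ_{j≠i} W_j(x)/(x_i − x_j)`. -/
def sigmaf {n : ℕ} {K : Type*} [NormedField K] (f : Polynomial K) (x : Fin n → K)
    (i : Fin n) : K :=
  ∑ j ∈ univ.erase i, Wc f x j / (x i - x j)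

/-- The Ehrlich iteration function. -/
def PhiE {n : ℕ} {K : Type*} [NormedField K] (f : Polynomial K) (x : Fin n → K) : Fin n → K :=
  fun i => x i - Wc f x i / (1 + sigmaf f x i)

/-- The Prešić–Tanabe iteration function. -/
def TnbE {n : ℕ} {K : Type*} [NormedField K] (f : Polynomial K) (x : Fin n → K) : Fin n → K :=
  fun i => x i - Wc f x i * (1 - sigmaf f x i)

/-- `ξ` is a root vector of `f`, i.e. `f(z) = C₀ ∏ (z − ξᵢ)`. -/
def IsRootVector {n : ℕ} {K : Type*} [NormedField K] (f : Polynomial K) (ξ : Fin n → K) : Prop :=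
  f = C f.leadingCoeff * ∏ i, (X - C (ξ i))

/-- `E_f(x)` in the case `p = ∞`: the max of `‖W_i(x)‖ / d_i(x)`. -/
def Einf {n : ℕ} {K : Type*} [NormedField K] (f : Polynomial K) (x : Fin n → K) : ℝ :=
  if h : (univ : Finset (Fin n)).Nonempty then univ.sup' h fun i => ‖Wc f x i‖ / dmin x i else 0

/-- The contraction rate of the Prešić–Tanabe corrections. -/
def tanabeRate (n : ℕ) (t : ℝ) : ℝ :=
  ((n : ℝ) - 1) * t ^ 2 * (1 + ((n : ℝ) - 1) * t) * ((n : ℝ) + ((n : ℝ) - 1) * t) /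
    ((1 - ((n : ℝ) - 1) * t) * (1 - t - ((n : ℝ) - 1) * t ^ 2)) *
  (1 + t * (1 + ((n : ℝ) - 1) * t) / (1 - 2 * t - 2 * ((n : ℝ) - 1) * t ^ 2)) ^ (n - 1)

section RealEstimates

lemma exp_fiftyTwo_div_eightyOne_lt : Real.exp (52 / 81) < 1.9004 := by
  have h1 : Real.exp (52 / 81) ^ 81 = Real.exp 1 ^ 52 := by
    rw [← Real.exp_nat_mul, ← Real.exp_nat_mul]; norm_num
  have h2 : Real.exp (52 / 81) ^ 81 < 1.9004 ^ 81 := by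
    rw [h1]
    calc Real.exp 1 ^ 52 < 2.7182818286 ^ 52 :=
          pow_lt_pow_left₀ Real.exp_one_lt_d9 (Real.exp_pos _).le (by norm_num)
      _ < 1.9004 ^ 81 := by norm_num
  exact lt_of_pow_lt_pow_left₀ 81 (by norm_num) h2

/-- The rate at the critical radius, written with `e = 1 / n`, without its power factor. -/
lemma rate_polynomial_lt {e : ℝ} (h0 : 0 < e) (h1 : e ≤ 1 / 10) :
    1.9004 * (16 / 81 * (1 - e) * (1 + 4 / 9 * e * (1 - e)) * (1 + 4 / 9 * (1 - e))) <
      (1 - 2 * (4 / 9 * e * (1 + 4 / 9 * (1 - e)))) * (1 - 4 / 9 * e * (1 + 4 / 9 * (1 - e))) *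
        (1 - 4 / 9 * (1 - e)) := by
  nlinarith [mul_pos h0 h0, mul_nonneg h0.le (sub_nonneg.2 h1), pow_pos h0 3, pow_pos h0 4,
    mul_nonneg (mul_pos h0 h0).le (sub_nonneg.2 h1),
    mul_nonneg (pow_pos h0 3).le (sub_nonneg.2 h1),
    mul_nonneg (pow_pos h0 4).le (sub_nonneg.2 h1)]

lemma one_add_pow_lt_of_one_div {n : ℕ} (hn : 2 ≤ n) {v : ℝ}
    (hv : v = 4 / 9 * (1 / (n : ℝ)) * (1 + 4 / 9 * (1 - 1 / (n : ℝ)))) :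
    (1 + v / (1 - 2 * v)) ^ (n - 1) < 1.9004 := by
  have hn' : (2 : ℝ) ≤ n := by exact_mod_cast hn
  have hnp : (0 : ℝ) < n := by linarith
  obtain ⟨e, he⟩ : ∃ e : ℝ, e = 1 / (n : ℝ) := ⟨_, rfl⟩
  have he0 : 0 < e := by rw [he]; positivity
  have he2 : e ≤ 1 / 2 := by rw [he]; exact one_div_le_one_div_of_le (by norm_num) hn'
  have hne : (n : ℝ) * e = 1 := by rw [he]; field_simp
  rw [← he] at hv
  have hv0 : 0 < v := by rw [hv]; have : 0 ≤ 1 - e := by linarith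
                         positivity
  have hd : 0 < 1 - 2 * v := by rw [hv]; nlinarith
  refine lt_of_le_of_lt ?_ exp_fiftyTwo_div_eightyOne_lt
  calc (1 + v / (1 - 2 * v)) ^ (n - 1) ≤ Real.exp (v / (1 - 2 * v)) ^ (n - 1) := by
        gcongr
        linarith [Real.add_one_le_exp (v / (1 - 2 * v))]
    _ = Real.exp (((n - 1 : ℕ) : ℝ) * (v / (1 - 2 * v))) := (Real.exp_nat_mul _ _).symm
    _ ≤ Real.exp (52 / 81) := by
        apply Real.exp_le_exp.2
        rw [Nat.cast_sub (by omega), ← mul_div_assoc, div_le_iff₀ hd]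
        have h3 : ((n : ℝ) - (1 : ℕ)) * v = 4 / 9 * (1 - e) * (1 + 4 / 9 * (1 - e)) := by
          rw [hv]; push_cast; linear_combination (4 / 9 * (1 + 4 / 9 * (1 - e))) * hne
        rw [h3, hv]
        nlinarith [mul_pos he0 he0]

lemma tanabeRate_lt_at_critical {n : ℕ} (hn : 2 ≤ n) :
    tanabeRate n (4 / (9 * (n : ℝ))) <
      1 - 2 * ((4 / (9 * (n : ℝ))) * (1 + ((n : ℝ) - 1) * (4 / (9 * (n : ℝ))))) := by
  rcases lt_or_ge n 10 with h | h
  · unfold tanabeRate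
    interval_cases n <;> norm_num
  · have hn' : (10 : ℝ) ≤ n := by exact_mod_cast h
    have hpow := one_add_pow_lt_of_one_div hn rfl
    obtain ⟨e, he⟩ : ∃ e : ℝ, e = 1 / (n : ℝ) := ⟨_, rfl⟩
    have he0 : 0 < e := by rw [he]; positivity
    have he1 : e ≤ 1 / 10 := by rw [he]; exact one_div_le_one_div_of_le (by norm_num) hn'
    have hne : (n : ℝ) * e = 1 := by rw [he]; field_simp
    rw [← he] at hpow
    have ht : 4 / (9 * (n : ℝ)) = 4 / 9 * e := by rw [he]; field_simp
    have hat : ((n : ℝ) - 1) * (4 / 9 * e) = 4 / 9 * (1 - e) := by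
      linear_combination 4 / 9 * hne
    have key := rate_polynomial_lt he0 he1
    obtain ⟨v, hv⟩ : ∃ v : ℝ, v = 4 / 9 * e * (1 + 4 / 9 * (1 - e)) := ⟨_, rfl⟩
    have hv1 : 1 - 4 / 9 * e - ((n : ℝ) - 1) * (4 / 9 * e) ^ 2 = 1 - v := by
      rw [hv]; linear_combination (-4 / 9 * e) * hat
    have hv2 : 1 - 2 * (4 / 9 * e) - 2 * ((n : ℝ) - 1) * (4 / 9 * e) ^ 2 = 1 - 2 * v := by
      rw [hv]; linear_combination (-2 * (4 / 9 * e)) * hat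
    have hnum : ((n : ℝ) - 1) * (4 / 9 * e) ^ 2 * (1 + 4 / 9 * (1 - e)) *
        ((n : ℝ) + 4 / 9 * (1 - e)) =
        16 / 81 * (1 - e) * (1 + 4 / 9 * e * (1 - e)) * (1 + 4 / 9 * (1 - e)) := by
      have h4 : 4 / 9 * e * ((n : ℝ) + 4 / 9 * (1 - e)) =
          4 / 9 * (1 + 4 / 9 * e * (1 - e)) := by linear_combination 4 / 9 * hne
      calc _ = (((n : ℝ) - 1) * (4 / 9 * e)) * (4 / 9 * e * ((n : ℝ) + 4 / 9 * (1 - e))) *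
            (1 + 4 / 9 * (1 - e)) := by ring
        _ = _ := by rw [hat, h4]; ring
    unfold tanabeRate
    rw [ht, hv1, hv2, hat, hnum, ← hv]
    rw [← hv] at hpow key
    have hv0 : 0 < v := by rw [hv]; have : 0 ≤ 1 - e := by linarith
                           positivity
    have hvs : v < 1 := by rw [hv]; nlinarith
    have hdd : 0 < (1 - 4 / 9 * (1 - e)) * (1 - v) := mul_pos (by linarith) (by linarith)
    have hP : 0 < 16 / 81 * (1 - e) * (1 + 4 / 9 * e * (1 - e)) * (1 + 4 / 9 * (1 - e)) := by
      have : 0 < 1 - e := by linarith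
      positivity
    calc _ < 16 / 81 * (1 - e) * (1 + 4 / 9 * e * (1 - e)) * (1 + 4 / 9 * (1 - e)) /
          ((1 - 4 / 9 * (1 - e)) * (1 - v)) * 1.9004 :=
          mul_lt_mul_of_pos_left hpow (div_pos hP hdd)
      _ < 1 - 2 * v := by
          rw [div_mul_eq_mul_div, div_lt_iff₀ hdd]
          linarith

variable {n : ℕ} {s t : ℝ}

lemma bounds_of_le_critical (hn : 2 ≤ n) (h0 : 0 ≤ t) (h : t ≤ 4 / (9 * (n : ℝ))) :
    ((n : ℝ) - 1) * t < 1 ∧ 0 < 1 - 2 * t - 2 * ((n : ℝ) - 1) * t ^ 2 := by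
  have hn' : (2 : ℝ) ≤ n := by exact_mod_cast hn
  have h1 : t * (9 * n) ≤ 4 := (le_div_iff₀ (by positivity)).1 h
  have h3 : t ≤ 2 / 9 := by nlinarith
  have h2 : ((n : ℝ) - 1) * t ≤ 4 / 9 - t := by nlinarith
  constructor
  · linarith
  · nlinarith

lemma tanabeRate_mono (hn : 2 ≤ n) (h0 : 0 ≤ s) (hst : s ≤ t) (h : t ≤ 4 / (9 * (n : ℝ))) :
    tanabeRate n s ≤ tanabeRate n t := by
  have hn' : (2 : ℝ) ≤ n := by exact_mod_cast hn
  obtain ⟨h1, h2⟩ := bounds_of_le_critical hn (h0.trans hst) h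
  obtain ⟨h3, h4⟩ := bounds_of_le_critical hn h0 (hst.trans h)
  have ht0 := h0.trans hst
  have ha : 0 ≤ (n : ℝ) - 1 := by linarith
  have h5 : 0 < 1 - t - ((n : ℝ) - 1) * t ^ 2 := by nlinarith
  have h6 : 0 < 1 - ((n : ℝ) - 1) * t := by linarith
  unfold tanabeRate
  have : 0 ≤ s * (1 + (↑n - 1) * s) := by positivity
  gcongr

lemma tanabeRate_nonneg (hn : 2 ≤ n) (h0 : 0 ≤ t) (h : t ≤ 4 / (9 * (n : ℝ))) :
    0 ≤ tanabeRate n t := by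
  have h1 := tanabeRate_mono hn le_rfl h0 h
  simpa [tanabeRate] using h1

lemma tanabeRate_add_lt_one (hn : 2 ≤ n) (h0 : 0 ≤ t) (h : t ≤ 4 / (9 * (n : ℝ))) :
    tanabeRate n t < 1 - 2 * (t * (1 + ((n : ℝ) - 1) * t)) := by
  have hn' : (2 : ℝ) ≤ n := by exact_mod_cast hn
  have ha : 0 ≤ (n : ℝ) - 1 := by linarith
  refine (tanabeRate_mono hn h0 h le_rfl).trans_lt ((tanabeRate_lt_at_critical hn).trans_le ?_)
  gcongr

end RealEstimates

section Corrections

variable {n : ℕ} {K : Type*} [NormedField K] {f : Polynomial K} {x : Fin n → K}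

lemma erase_univ_nonempty (hn : 2 ≤ n) (i : Fin n) : (univ.erase i).Nonempty := by
  rw [← Finset.card_pos, card_erase_of_mem (mem_univ i), card_univ, Fintype.card_fin]
  omega

lemma dmin_le {i j : Fin n} (hij : j ≠ i) : dmin x i ≤ ‖x i - x j‖ := by
  have hj : j ∈ univ.erase i := mem_erase.2 ⟨hij, mem_univ j⟩
  rw [dmin, dif_pos ⟨j, hj⟩]
  exact inf'_le _ hj

lemma exists_dmin_eq (hn : 2 ≤ n) (x : Fin n → K) (i : Fin n) :
    ∃ j, j ≠ i ∧ dmin x i = ‖x i - x j‖ := by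
  have h := erase_univ_nonempty hn i
  obtain ⟨j, hj, hj'⟩ := exists_mem_eq_inf' h fun j => ‖x i - x j‖
  exact ⟨j, (mem_erase.1 hj).1, by rw [dmin, dif_pos h, hj']⟩

lemma dmin_pos (hn : 2 ≤ n) (hx : Function.Injective x) (i : Fin n) : 0 < dmin x i := by
  obtain ⟨j, hj, h⟩ := exists_dmin_eq hn x i
  rw [h, norm_pos_iff, sub_ne_zero]
  exact fun h => hj (hx h).symm

lemma Einf_nonneg (hn : 2 ≤ n) (hx : Function.Injective x) : 0 ≤ Einf f x := by
  have h : (univ : Finset (Fin n)).Nonempty := ⟨⟨0, by omega⟩, mem_univ _⟩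
  rw [Einf, dif_pos h]
  exact le_sup'_of_le _ (mem_univ (⟨0, by omega⟩ : Fin n))
    (div_nonneg (norm_nonneg _) (dmin_pos hn hx _).le)

lemma norm_Wc_le (hn : 2 ≤ n) (hx : Function.Injective x) {i j : Fin n} (hij : i ≠ j) :
    ‖Wc f x i‖ ≤ Einf f x * ‖x i - x j‖ := by
  have h : (univ : Finset (Fin n)).Nonempty := ⟨i, mem_univ _⟩
  have h1 : ‖Wc f x i‖ / dmin x i ≤ Einf f x := by
    rw [Einf, dif_pos h]
    exact le_sup' (fun i => ‖Wc f x i‖ / dmin x i) (mem_univ i)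
  rw [div_le_iff₀ (dmin_pos hn hx i)] at h1
  exact h1.trans (mul_le_mul_of_nonneg_left (dmin_le hij.symm) (Einf_nonneg hn hx))

lemma Einf_le (hn : 2 ≤ n) (hx : Function.Injective x) {c : ℝ}
    (h : ∀ i j, i ≠ j → ‖Wc f x i‖ ≤ c * ‖x i - x j‖) : Einf f x ≤ c := by
  have hne : (univ : Finset (Fin n)).Nonempty := ⟨⟨0, by omega⟩, mem_univ _⟩
  rw [Einf, dif_pos hne]
  refine sup'_le _ _ fun i _ => ?_
  obtain ⟨j, hj, hd⟩ := exists_dmin_eq hn x i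
  rw [div_le_iff₀ (dmin_pos hn hx i), hd]
  exact h i j hj.symm

lemma degree_sub_nodal_lt (hdeg : f.degree = (n : ℕ)) (x : Fin n → K) :
    (f - C f.leadingCoeff * Lagrange.nodal univ x).degree < #(univ : Finset (Fin n)) := by
  have hf : f ≠ 0 := by rintro rfl; simp at hdeg
  have hc : f.leadingCoeff ≠ 0 := leadingCoeff_ne_zero.2 hf
  have hnodal : (C f.leadingCoeff * Lagrange.nodal univ x).degree = f.degree := by
    rw [degree_C_mul hc, Lagrange.degree_nodal, hdeg, card_univ, Fintype.card_fin]
  have h := degree_sub_lt_left hnodal.symm hf (by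
    rw [leadingCoeff_mul, leadingCoeff_C, Lagrange.nodal_monic.leadingCoeff, mul_one])
  rw [card_univ, Fintype.card_fin]
  rwa [hdeg] at h

/-- Lagrange interpolation at the nodes `x`, in terms of the Weierstrass corrections. -/
lemma eval_eq_Wc (hdeg : f.degree = (n : ℕ)) (hx : Function.Injective x) (z : K) :
    eval z f = f.leadingCoeff *
      (∏ j, (z - x j) + ∑ k, Wc f x k * ∏ j ∈ univ.erase k, (z - x j)) := by
  have hc : f.leadingCoeff ≠ 0 := leadingCoeff_ne_zero.2 (by rintro rfl; simp at hdeg)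
  have key := Lagrange.eq_interpolate_of_eval_eq (s := univ) (v := x) (fun i => eval (x i) f)
    hx.injOn (degree_sub_nodal_lt hdeg x) (fun i hi => by simp [Lagrange.eval_nodal_at_node hi])
  have h := congrArg (eval z) key
  rw [eval_sub, eval_mul, eval_C, Lagrange.eval_nodal, sub_eq_iff_eq_add'] at h
  rw [h, mul_add, Lagrange.interpolate_apply, eval_finsetSum, mul_sum]
  congr 1
  refine sum_congr rfl fun k _ => ?_
  rw [eval_mul, eval_C, Lagrange.basis, eval_prod, Wc]
  simp only [Lagrange.basisDivisor, eval_mul, eval_C, eval_sub, eval_X]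
  rw [prod_mul_distrib, prod_inv_distrib]
  field_simp

lemma eval_eq_Wc_mul_prod (hdeg : f.degree = (n : ℕ)) (hx : Function.Injective x) (i : Fin n) :
    eval (x i) f = Wc f x i * (f.leadingCoeff * ∏ j ∈ univ.erase i, (x i - x j)) := by
  have hf : f ≠ 0 := by rintro rfl; simp at hdeg
  refine (div_mul_cancel₀ _ (mul_ne_zero (leadingCoeff_ne_zero.2 hf) ?_)).symm
  exact prod_ne_zero_iff.2 fun j hj => sub_ne_zero.2 fun h => (mem_erase.1 hj).1 (hx h).symm

lemma isRootVector_of_injective (hdeg : f.degree = (n : ℕ)) (hx : Function.Injective x)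
    (h0 : ∀ i, eval (x i) f = 0) : IsRootVector f x := by
  change f = C f.leadingCoeff * Lagrange.nodal univ x
  exact eq_of_degree_sub_lt_of_eval_index_eq univ hx.injOn (degree_sub_nodal_lt hdeg x)
    (fun i hi => by rw [h0 i, eval_mul, Lagrange.eval_nodal_at_node hi, mul_zero])

/-- The value of `f` after one Prešić–Tanabe step of the `i`-th component. -/
lemma eval_TnbE (hdeg : f.degree = (n : ℕ)) (hx : Function.Injective x) (i : Fin n)
    (hne : ∀ j, j ≠ i → TnbE f x i ≠ x j) :
    eval (TnbE f x i) f = f.leadingCoeff * ((∏ j ∈ univ.erase i, (TnbE f x i - x j)) *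
      (Wc f x i * (sigmaf f x i ^ 2 + (1 - sigmaf f x i) * ∑ j ∈ univ.erase i,
        Wc f x j * (TnbE f x i - x i) / ((x i - x j) * (TnbE f x i - x j))))) := by
  obtain ⟨y, hy⟩ : ∃ y, y = TnbE f x i := ⟨_, rfl⟩
  rw [← hy] at hne ⊢
  have hy' : y - x i = - (Wc f x i * (1 - sigmaf f x i)) := by rw [hy, TnbE]; ring
  rw [eval_eq_Wc hdeg hx]
  congr 1
  have h1 : ∏ j, (y - x j) = (y - x i) * ∏ j ∈ univ.erase i, (y - x j) :=
    (mul_prod_erase _ _ (mem_univ i)).symm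
  have h2 : ∑ k, Wc f x k * ∏ j ∈ univ.erase k, (y - x j) =
      Wc f x i * ∏ j ∈ univ.erase i, (y - x j) + (∏ j ∈ univ.erase i, (y - x j)) *
        ((y - x i) * ∑ k ∈ univ.erase i, Wc f x k / (y - x k)) := by
    rw [← add_sum_erase _ _ (mem_univ i), mul_sum, mul_sum]
    congr 1
    refine sum_congr rfl fun k hk => ?_
    have hki := (mem_erase.1 hk).1
    have hyk : y - x k ≠ 0 := sub_ne_zero.2 (hne k hki)
    have h3 : (y - x k) * ∏ j ∈ univ.erase k, (y - x j) =
        (y - x i) * ∏ j ∈ univ.erase i, (y - x j) := by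
      rw [mul_prod_erase _ (fun j => y - x j) (mem_univ k),
        mul_prod_erase _ (fun j => y - x j) (mem_univ i)]
    field_simp
    linear_combination Wc f x k * h3
  have h4 : ∑ k ∈ univ.erase i, Wc f x k / (y - x k) = sigmaf f x i -
      ∑ j ∈ univ.erase i, Wc f x j * (y - x i) / ((x i - x j) * (y - x j)) := by
    rw [sigmaf, ← sum_sub_distrib]
    refine sum_congr rfl fun k hk => ?_
    have hki := (mem_erase.1 hk).1
    have hyk : y - x k ≠ 0 := sub_ne_zero.2 (hne k hki)
    have hxk : x i - x k ≠ 0 := sub_ne_zero.2 fun h => hki (hx h).symm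
    field_simp
    ring
  rw [h1, h2, h4]
  generalize (∑ j ∈ univ.erase i, Wc f x j * (y - x i) / ((x i - x j) * (y - x j))) = δ
  rw [hy']
  ring

variable {E : ℝ}

lemma norm_sigmaf_le (hx : Function.Injective x)
    (hW : ∀ i j, i ≠ j → ‖Wc f x i‖ ≤ E * ‖x i - x j‖) (i : Fin n) :
    ‖sigmaf f x i‖ ≤ ((n : ℝ) - 1) * E := by
  have hcard : ((#(univ.erase i) : ℕ) : ℝ) = (n : ℝ) - 1 := by
    rw [card_erase_of_mem (mem_univ i), card_univ, Fintype.card_fin, Nat.cast_sub i.pos]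
    simp
  rw [sigmaf, ← hcard, ← nsmul_eq_mul]
  refine (norm_sum_le _ _).trans (sum_le_card_nsmul _ _ _ fun j hj => ?_)
  have hji := (mem_erase.1 hj).1
  rw [norm_div, div_le_iff₀ (norm_pos_iff.2 (sub_ne_zero.2 fun h => hji (hx h).symm)),
    norm_sub_rev]
  exact hW j i hji

lemma norm_TnbE_sub_le (hx : Function.Injective x)
    (hW : ∀ i j, i ≠ j → ‖Wc f x i‖ ≤ E * ‖x i - x j‖) (i : Fin n) :
    ‖TnbE f x i - x i‖ ≤ (1 + ((n : ℝ) - 1) * E) * ‖Wc f x i‖ := by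
  have h : TnbE f x i - x i = - (Wc f x i * (1 - sigmaf f x i)) := by rw [TnbE]; ring
  rw [h, norm_neg, norm_mul, mul_comm]
  refine mul_le_mul_of_nonneg_right ((norm_sub_le _ _).trans ?_) (norm_nonneg _)
  rw [norm_one]
  linarith [norm_sigmaf_le hx hW i]

lemma norm_TnbE_sub_le' (hn : 2 ≤ n) (hE : 0 ≤ E) (hx : Function.Injective x)
    (hW : ∀ i j, i ≠ j → ‖Wc f x i‖ ≤ E * ‖x i - x j‖) {i j : Fin n} (hij : i ≠ j) :
    ‖TnbE f x i - x i‖ ≤ E * (1 + ((n : ℝ) - 1) * E) * ‖x i - x j‖ := by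
  have hn' : (2 : ℝ) ≤ n := by exact_mod_cast hn
  have ha : 0 ≤ (n : ℝ) - 1 := by linarith
  calc _ ≤ (1 + ((n : ℝ) - 1) * E) * ‖Wc f x i‖ := norm_TnbE_sub_le hx hW i
    _ ≤ (1 + ((n : ℝ) - 1) * E) * (E * ‖x i - x j‖) := by gcongr; exact hW i j hij
    _ = _ := by ring

lemma le_norm_TnbE_sub (hn : 2 ≤ n) (hE : 0 ≤ E) (hx : Function.Injective x)
    (hW : ∀ i j, i ≠ j → ‖Wc f x i‖ ≤ E * ‖x i - x j‖) {i j : Fin n} (hij : i ≠ j) :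
    (1 - E * (1 + ((n : ℝ) - 1) * E)) * ‖x i - x j‖ ≤ ‖TnbE f x i - x j‖ := by
  have h1 := norm_TnbE_sub_le' hn hE hx hW hij
  have h2 : ‖x i - x j‖ ≤ ‖TnbE f x i - x j‖ + ‖TnbE f x i - x i‖ := by
    have h : x i - x j = (TnbE f x i - x j) - (TnbE f x i - x i) := by ring
    rw [h]; exact norm_sub_le _ _
  linarith

lemma le_norm_TnbE_sub_TnbE (hn : 2 ≤ n) (hE : 0 ≤ E) (hx : Function.Injective x)
    (hW : ∀ i j, i ≠ j → ‖Wc f x i‖ ≤ E * ‖x i - x j‖) {i j : Fin n} (hij : i ≠ j) :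
    (1 - 2 * (E * (1 + ((n : ℝ) - 1) * E))) * ‖x i - x j‖ ≤ ‖TnbE f x i - TnbE f x j‖ := by
  have h1 := le_norm_TnbE_sub hn hE hx hW hij
  have h3 := norm_TnbE_sub_le' hn hE hx hW hij.symm
  have h2 : ‖TnbE f x i - x j‖ ≤ ‖TnbE f x i - TnbE f x j‖ + ‖TnbE f x j - x j‖ := by
    have h : TnbE f x i - x j = (TnbE f x i - TnbE f x j) + (TnbE f x j - x j) := by ring
    rw [h]; exact norm_add_le _ _
  rw [norm_sub_rev (x j)] at h3
  linarith

/-- One Prešić–Tanabe step contracts the Weierstrass corrections. -/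
lemma norm_Wc_TnbE_le (hn : 2 ≤ n) (hdeg : f.degree = (n : ℕ)) (hE : 0 ≤ E)
    (hx : Function.Injective x) (hW : ∀ i j, i ≠ j → ‖Wc f x i‖ ≤ E * ‖x i - x j‖)
    (haE : ((n : ℝ) - 1) * E < 1) (h2 : 0 < 1 - 2 * E - 2 * ((n : ℝ) - 1) * E ^ 2)
    (i : Fin n) : ‖Wc f (TnbE f x) i‖ ≤ tanabeRate n E * ‖Wc f x i‖ := by
  have hn' : (2 : ℝ) ≤ n := by exact_mod_cast hn
  obtain ⟨a, ha⟩ : ∃ a : ℝ, a = (n : ℝ) - 1 := ⟨_, rfl⟩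
  have ha0 : 0 ≤ a := by linarith
  obtain ⟨v, hv⟩ : ∃ v : ℝ, v = E * (1 + a * E) := ⟨_, rfl⟩
  have hv0 : 0 ≤ v := by rw [hv]; positivity
  have hv2 : 0 < 1 - 2 * v := by rw [hv, ha]; linarith
  have hv1 : 0 < 1 - v := by linarith
  have hxpos : ∀ j, j ≠ i → 0 < ‖x i - x j‖ := fun j hj =>
    norm_pos_iff.2 (sub_ne_zero.2 fun h => hj (hx h).symm)
  have hlow1 : ∀ j, j ≠ i → (1 - v) * ‖x i - x j‖ ≤ ‖TnbE f x i - x j‖ := fun j hj => by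
    rw [hv, ha]; exact le_norm_TnbE_sub hn hE hx hW hj.symm
  have hlow2 : ∀ j, j ≠ i → (1 - 2 * v) * ‖x i - x j‖ ≤ ‖TnbE f x i - TnbE f x j‖ :=
    fun j hj => by rw [hv, ha]; exact le_norm_TnbE_sub_TnbE hn hE hx hW hj.symm
  have hpos1 : ∀ j, j ≠ i → 0 < ‖TnbE f x i - x j‖ := fun j hj =>
    (mul_pos hv1 (hxpos j hj)).trans_le (hlow1 j hj)
  have hpos2 : ∀ j, j ≠ i → 0 < ‖TnbE f x i - TnbE f x j‖ := fun j hj =>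
    (mul_pos hv2 (hxpos j hj)).trans_le (hlow2 j hj)
  have hcard : #(univ.erase i) = n - 1 := by
    rw [card_erase_of_mem (mem_univ i), card_univ, Fintype.card_fin]
  have hcard' : ((#(univ.erase i) : ℕ) : ℝ) = a := by
    rw [hcard, ha, Nat.cast_sub i.pos]; simp
  have hsig : ‖sigmaf f x i‖ ≤ a * E := by rw [ha]; exact norm_sigmaf_le hx hW i
  have hδ : ‖∑ j ∈ univ.erase i,
      Wc f x j * (TnbE f x i - x i) / ((x i - x j) * (TnbE f x i - x j))‖ ≤
      a * (E * (v / (1 - v))) := by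
    rw [← hcard', ← nsmul_eq_mul]
    refine (norm_sum_le _ _).trans (sum_le_card_nsmul _ _ _ fun j hj => ?_)
    have hji := (mem_erase.1 hj).1
    rw [norm_div, norm_mul, norm_mul, mul_div_mul_comm]
    have hA : ‖Wc f x j‖ / ‖x i - x j‖ ≤ E := by
      rw [div_le_iff₀ (hxpos j hji), norm_sub_rev]; exact hW j i hji
    have hB : ‖TnbE f x i - x i‖ / ‖TnbE f x i - x j‖ ≤ v / (1 - v) := by
      rw [div_le_div_iff₀ (hpos1 j hji) hv1]
      have h3 := norm_TnbE_sub_le' hn hE hx hW hji.symm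
      rw [← ha, ← hv] at h3
      calc _ ≤ v * ‖x i - x j‖ * (1 - v) := by gcongr
        _ = v * ((1 - v) * ‖x i - x j‖) := by ring
        _ ≤ _ := by gcongr; exact hlow1 j hji
    exact mul_le_mul hA hB (by positivity) hE
  have hprod : ∏ j ∈ univ.erase i, (‖TnbE f x i - x j‖ / ‖TnbE f x i - TnbE f x j‖) ≤
      (1 + v / (1 - 2 * v)) ^ (n - 1) := by
    rw [← hcard]
    rw [← prod_const]
    refine prod_le_prod (fun j _ => by positivity) fun j hj => ?_
    have hji := (mem_erase.1 hj).1
    rw [div_le_iff₀ (hpos2 j hji)]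
    have h3 := norm_TnbE_sub_le' hn hE hx hW hji
    rw [← ha, ← hv, norm_sub_rev (x j)] at h3
    have h4 : ‖TnbE f x i - x j‖ ≤ ‖TnbE f x i - TnbE f x j‖ + ‖TnbE f x j - x j‖ := by
      have h : TnbE f x i - x j = (TnbE f x i - TnbE f x j) + (TnbE f x j - x j) := by ring
      rw [h]; exact norm_add_le _ _
    have h5 : v * ‖x i - x j‖ ≤ v / (1 - 2 * v) * ‖TnbE f x i - TnbE f x j‖ := by
      calc v * ‖x i - x j‖ = v / (1 - 2 * v) * ((1 - 2 * v) * ‖x i - x j‖) := by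
            rw [← mul_assoc, div_mul_cancel₀ _ hv2.ne']
        _ ≤ _ := by gcongr; exact hlow2 j hji
    linarith
  have hf : f ≠ 0 := by rintro rfl; simp at hdeg
  have hc : f.leadingCoeff ≠ 0 := leadingCoeff_ne_zero.2 hf
  have hrate : tanabeRate n E = a * E ^ 2 * (1 + a * E) * ((n : ℝ) + a * E) /
      ((1 - a * E) * (1 - v)) * (1 + v / (1 - 2 * v)) ^ (n - 1) := by
    have e1 : 1 - E - a * E ^ 2 = 1 - v := by rw [hv]; ring
    have e2 : 1 - 2 * E - 2 * a * E ^ 2 = 1 - 2 * v := by rw [hv]; ring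
    rw [tanabeRate, ← ha, e1, e2, ← hv]
  have hmain : ‖sigmaf f x i ^ 2 + (1 - sigmaf f x i) * ∑ j ∈ univ.erase i,
      Wc f x j * (TnbE f x i - x i) / ((x i - x j) * (TnbE f x i - x j))‖ ≤
      a * E ^ 2 * (1 + a * E) * ((n : ℝ) + a * E) / ((1 - a * E) * (1 - v)) := by
    rw [← ha] at haE
    have h1 : ‖1 - sigmaf f x i‖ ≤ 1 + a * E := by
      refine (norm_sub_le _ _).trans ?_
      rw [norm_one]; linarith
    calc _ ≤ ‖sigmaf f x i‖ ^ 2 + ‖1 - sigmaf f x i‖ * ‖∑ j ∈ univ.erase i,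
          Wc f x j * (TnbE f x i - x i) / ((x i - x j) * (TnbE f x i - x j))‖ := by
          rw [← norm_pow, ← norm_mul]; exact norm_add_le _ _
      _ ≤ (a * E) ^ 2 + (1 + a * E) * (a * (E * (v / (1 - v)))) := by gcongr
      _ = a * E ^ 2 * (a * (1 - v) + (1 + a * E) ^ 2) / (1 - v) := by
          have : v / (1 - v) = E * ((1 + a * E) / (1 - v)) := by rw [← mul_div_assoc, ← hv]
          rw [this]; field_simp
      _ ≤ a * E ^ 2 * ((1 + a * E) * ((n : ℝ) + a * E)) / (1 - v) := by
          have : a * (1 - v) + (1 + a * E) ^ 2 ≤ (1 + a * E) * ((n : ℝ) + a * E) := by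
            have hna : (n : ℝ) = a + 1 := by linarith
            rw [hna]
            nlinarith [mul_nonneg ha0 hv0, mul_nonneg ha0 (mul_nonneg ha0 hE)]
          gcongr
      _ ≤ _ := by
          rw [← mul_assoc]
          have h3 : 0 < 1 - a * E := by linarith
          apply div_le_div_of_nonneg_left (by positivity) (mul_pos h3 hv1)
          have h4 : 0 ≤ a * E := by positivity
          nlinarith
  have hWy : ‖Wc f (TnbE f x) i‖ = (∏ j ∈ univ.erase i,
      (‖TnbE f x i - x j‖ / ‖TnbE f x i - TnbE f x j‖)) * (‖Wc f x i‖ *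
      ‖sigmaf f x i ^ 2 + (1 - sigmaf f x i) * ∑ j ∈ univ.erase i,
      Wc f x j * (TnbE f x i - x i) / ((x i - x j) * (TnbE f x i - x j))‖) := by
    rw [Wc, eval_TnbE hdeg hx i fun j hj => sub_ne_zero.1 (norm_pos_iff.1 (hpos1 j hj)),
      mul_div_mul_left _ _ hc, mul_div_right_comm, norm_mul, norm_mul, norm_div, norm_prod,
      norm_prod, prod_div_distrib]
  rw [hWy, hrate]
  calc _ ≤ (1 + v / (1 - 2 * v)) ^ (n - 1) * (‖Wc f x i‖ *
        (a * E ^ 2 * (1 + a * E) * ((n : ℝ) + a * E) / ((1 - a * E) * (1 - v)))) := by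
        gcongr
    _ = _ := by ring

end Corrections

section Convergence

variable {n : ℕ} {K : Type*} [NormedField K] {f : Polynomial K} {x : Fin n → K}

lemma norm_Wc_TnbE_le_tanabeRate (hn : 2 ≤ n) (hdeg : f.degree = (n : ℕ))
    (hx : Function.Injective x) (hE : Einf f x ≤ 4 / (9 * (n : ℝ))) (i : Fin n) :
    ‖Wc f (TnbE f x) i‖ ≤ tanabeRate n (Einf f x) * ‖Wc f x i‖ := by
  have h0 := Einf_nonneg (f := f) hn hx
  obtain ⟨h1, h2⟩ := bounds_of_le_critical hn h0 hE
  exact norm_Wc_TnbE_le hn hdeg h0 hx (fun i j hij => norm_Wc_le hn hx hij) h1 h2 i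

lemma TnbE_injective (hn : 2 ≤ n) (hx : Function.Injective x)
    (hE : Einf f x ≤ 4 / (9 * (n : ℝ))) : Function.Injective (TnbE f x) := by
  have h0 := Einf_nonneg (f := f) hn hx
  obtain ⟨-, h2⟩ := bounds_of_le_critical hn h0 hE
  intro i j h
  by_contra hij
  have h3 := le_norm_TnbE_sub_TnbE hn h0 hx (fun i j hij => norm_Wc_le (f := f) hn hx hij) hij
  rw [h, sub_self, norm_zero] at h3
  have h4 : 0 < ‖x i - x j‖ := norm_pos_iff.2 (sub_ne_zero.2 fun h => hij (hx h))
  nlinarith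

lemma Einf_TnbE_le (hn : 2 ≤ n) (hdeg : f.degree = (n : ℕ)) (hx : Function.Injective x)
    (hE : Einf f x ≤ 4 / (9 * (n : ℝ))) : Einf f (TnbE f x) ≤ Einf f x := by
  have h0 := Einf_nonneg (f := f) hn hx
  have hrate := tanabeRate_add_lt_one hn h0 hE
  refine Einf_le hn (TnbE_injective hn hx hE) fun i j hij => ?_
  have hW : ∀ i j, i ≠ j → ‖Wc f x i‖ ≤ Einf f x * ‖x i - x j‖ :=
    fun i j hij => norm_Wc_le hn hx hij
  calc _ ≤ tanabeRate n (Einf f x) * ‖Wc f x i‖ := norm_Wc_TnbE_le_tanabeRate hn hdeg hx hE i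
    _ ≤ (1 - 2 * (Einf f x * (1 + ((n : ℝ) - 1) * Einf f x))) *
        (Einf f x * ‖x i - x j‖) := by
        have := tanabeRate_nonneg hn h0 hE
        exact mul_le_mul hrate.le (hW i j hij) (norm_nonneg _) (this.trans hrate.le)
    _ = Einf f x * ((1 - 2 * (Einf f x * (1 + ((n : ℝ) - 1) * Einf f x))) * ‖x i - x j‖) := by
        ring
    _ ≤ _ := by gcongr; exact le_norm_TnbE_sub_TnbE hn h0 hx hW hij

lemma TnbE_iterate_spec (hn : 2 ≤ n) (hdeg : f.degree = (n : ℕ)) (hx : Function.Injective x)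
    (hE : Einf f x ≤ 4 / (9 * (n : ℝ))) (k : ℕ) :
    Function.Injective ((TnbE f)^[k] x) ∧ Einf f ((TnbE f)^[k] x) ≤ Einf f x ∧
      ∀ i, ‖Wc f ((TnbE f)^[k] x) i‖ ≤ tanabeRate n (Einf f x) ^ k * ‖Wc f x i‖ := by
  induction k with
  | zero => simpa using hx
  | succ k ih =>
    obtain ⟨h1, h2, h3⟩ := ih
    have h4 := h2.trans hE
    simp only [Function.iterate_succ_apply']
    refine ⟨TnbE_injective hn h1 h4, (Einf_TnbE_le hn hdeg h1 h4).trans h2, fun i => ?_⟩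
    have h0 := Einf_nonneg (f := f) hn h1
    calc _ ≤ tanabeRate n (Einf f ((TnbE f)^[k] x)) * ‖Wc f ((TnbE f)^[k] x) i‖ :=
          norm_Wc_TnbE_le_tanabeRate hn hdeg h1 h4 i
      _ ≤ tanabeRate n (Einf f x) * (tanabeRate n (Einf f x) ^ k * ‖Wc f x i‖) :=
          mul_le_mul (tanabeRate_mono hn h0 h2 hE) (h3 i) (norm_nonneg _)
            (tanabeRate_nonneg hn (h0.trans h2) hE)
      _ = _ := by ring

lemma dist_TnbE_iterate_succ_le (hn : 2 ≤ n) (hdeg : f.degree = (n : ℕ))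
    (hx : Function.Injective x) (hE : Einf f x ≤ 4 / (9 * (n : ℝ))) (i : Fin n) (k : ℕ) :
    dist ((TnbE f)^[k] x i) ((TnbE f)^[k + 1] x i) ≤
      (1 + ((n : ℝ) - 1) * Einf f x) * ‖Wc f x i‖ * tanabeRate n (Einf f x) ^ k := by
  have hn' : (2 : ℝ) ≤ n := by exact_mod_cast hn
  have ha : 0 ≤ (n : ℝ) - 1 := by linarith
  obtain ⟨h1, h2, h3⟩ := TnbE_iterate_spec hn hdeg hx hE k
  have h0 := Einf_nonneg (f := f) hn hx
  rw [Function.iterate_succ_apply', dist_comm, dist_eq_norm]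
  calc _ ≤ (1 + ((n : ℝ) - 1) * Einf f ((TnbE f)^[k] x)) * ‖Wc f ((TnbE f)^[k] x) i‖ :=
        norm_TnbE_sub_le h1 (fun i j hij => norm_Wc_le hn h1 hij) i
    _ ≤ (1 + ((n : ℝ) - 1) * Einf f x) * (tanabeRate n (Einf f x) ^ k * ‖Wc f x i‖) := by
        gcongr
        exact h3 i
    _ = _ := by ring

lemma tanabeRate_Einf_lt_one (hn : 2 ≤ n) (hx : Function.Injective x)
    (hE : Einf f x ≤ 4 / (9 * (n : ℝ))) : tanabeRate n (Einf f x) < 1 := by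
  have hn' : (2 : ℝ) ≤ n := by exact_mod_cast hn
  have ha : 0 ≤ (n : ℝ) - 1 := by linarith
  have h0 := Einf_nonneg (f := f) hn hx
  refine (tanabeRate_add_lt_one hn h0 hE).trans_le ?_
  have : 0 ≤ Einf f x * (1 + ((n : ℝ) - 1) * Einf f x) := by positivity
  linarith

/-- A limit of the iteration lies in the initial inclusion disks. -/
lemma mem_closedBall_of_tendsto (hn : 2 ≤ n) (hdeg : f.degree = (n : ℕ))
    (hx : Function.Injective x) (hE : Einf f x ≤ 4 / (9 * (n : ℝ))) {i : Fin n} {z : K}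
    (hz : Tendsto (fun k => (TnbE f)^[k] x i) atTop (nhds z)) :
    z ∈ Metric.closedBall (x i) ((1 + ((n : ℝ) - 1) * Einf f x) /
      (1 - tanabeRate n (Einf f x)) * ‖Wc f x i‖) := by
  have h := dist_le_of_le_geometric_of_tendsto₀ _ _ (tanabeRate_Einf_lt_one hn hx hE)
    (dist_TnbE_iterate_succ_le hn hdeg hx hE i) hz
  rw [Metric.mem_closedBall, dist_comm]
  refine h.trans_eq ?_
  ring

/-- The inclusion disks are mutually disjoint. -/
lemma disjoint_closedBall (hn : 2 ≤ n) (hx : Function.Injective x)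
    (hE : Einf f x ≤ 4 / (9 * (n : ℝ))) {i j : Fin n} (hij : i ≠ j) :
    Disjoint
      (Metric.closedBall (x i) ((1 + ((n : ℝ) - 1) * Einf f x) /
        (1 - tanabeRate n (Einf f x)) * ‖Wc f x i‖))
      (Metric.closedBall (x j) ((1 + ((n : ℝ) - 1) * Einf f x) /
        (1 - tanabeRate n (Einf f x)) * ‖Wc f x j‖)) := by
  have hn' : (2 : ℝ) ≤ n := by exact_mod_cast hn
  have ha : 0 ≤ (n : ℝ) - 1 := by linarith
  have h0 := Einf_nonneg (f := f) hn hx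
  have hrate := tanabeRate_add_lt_one hn h0 hE
  have hpos : 0 < 1 - tanabeRate n (Einf f x) := by
    linarith [tanabeRate_Einf_lt_one hn hx hE]
  have hd : 0 < ‖x i - x j‖ := norm_pos_iff.2 (sub_ne_zero.2 fun h => hij (hx h))
  have hWi : ‖Wc f x i‖ ≤ Einf f x * ‖x i - x j‖ := norm_Wc_le hn hx hij
  have hWj : ‖Wc f x j‖ ≤ Einf f x * ‖x i - x j‖ := by
    rw [norm_sub_rev]; exact norm_Wc_le hn hx hij.symm
  apply Metric.closedBall_disjoint_closedBall
  rw [← mul_add, div_mul_eq_mul_div, div_lt_iff₀ hpos, dist_eq_norm]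
  calc _ ≤ (1 + ((n : ℝ) - 1) * Einf f x) *
        (Einf f x * ‖x i - x j‖ + Einf f x * ‖x i - x j‖) := by gcongr
    _ = ‖x i - x j‖ * (2 * (Einf f x * (1 + ((n : ℝ) - 1) * Einf f x))) := by ring
    _ < _ := mul_lt_mul_of_pos_left (by linarith) hd

lemma exists_tendsto_TnbE_iterate [CompleteSpace K] (hn : 2 ≤ n) (hdeg : f.degree = (n : ℕ))
    (hx : Function.Injective x) (hE : Einf f x ≤ 4 / (9 * (n : ℝ))) :
    ∃ ξ : Fin n → K, Tendsto (fun k => (TnbE f)^[k] x) atTop (nhds ξ) := by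
  have h : ∀ i, ∃ z, Tendsto (fun k => (TnbE f)^[k] x i) atTop (nhds z) := fun i =>
    cauchySeq_tendsto_of_complete (cauchySeq_of_le_geometric _ _
      (tanabeRate_Einf_lt_one hn hx hE) (dist_TnbE_iterate_succ_le hn hdeg hx hE i))
  choose ξ hξ using h
  exact ⟨ξ, tendsto_pi_nhds.2 hξ⟩

lemma eval_eq_zero_of_tendsto (hn : 2 ≤ n) (hdeg : f.degree = (n : ℕ))
    (hx : Function.Injective x) (hE : Einf f x ≤ 4 / (9 * (n : ℝ))) {ξ : Fin n → K}
    (hξ : Tendsto (fun k => (TnbE f)^[k] x) atTop (nhds ξ)) (i : Fin n) :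
    eval (ξ i) f = 0 := by
  have hξ' := tendsto_pi_nhds.1 hξ
  have hW : Tendsto (fun k => Wc f ((TnbE f)^[k] x) i) atTop (nhds 0) := by
    refine squeeze_zero_norm (fun k => (TnbE_iterate_spec hn hdeg hx hE k).2.2 i) ?_
    rw [← zero_mul ‖Wc f x i‖]
    exact (tendsto_pow_atTop_nhds_zero_of_lt_one
      (tanabeRate_nonneg hn (Einf_nonneg hn hx) hE)
      (tanabeRate_Einf_lt_one hn hx hE)).mul_const _
  have h1 : Tendsto (fun k => eval ((TnbE f)^[k] x i) f) atTop (nhds (eval (ξ i) f)) :=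
    (f.continuous.tendsto _).comp (hξ' i)
  have h2 : Tendsto (fun k => eval ((TnbE f)^[k] x i) f) atTop (nhds (0 *
      (f.leadingCoeff * ∏ j ∈ univ.erase i, (ξ i - ξ j)))) := by
    simp_rw [fun k => eval_eq_Wc_mul_prod hdeg (TnbE_iterate_spec hn hdeg hx hE k).1 i]
    exact hW.mul (tendsto_const_nhds.mul
      (tendsto_finsetProd _ fun j _ => (hξ' i).sub (hξ' j)))
  rw [zero_mul] at h2
  exact tendsto_nhds_unique h1 h2

end Convergence

/-- Proinov, Corollary 4.6 (the case `p = ∞`, `q = 1`, `a = n − 1`, `b = 2`). -/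
theorem stmt_19 {n : ℕ} {K : Type*} [NormedField K] [CompleteSpace K] (hn : 2 ≤ n)
    (f : Polynomial K) (hdeg : f.degree = (n : ℕ))
    (γ β : ℝ → ℝ)
    (hγ : ∀ t, γ t = 1 + ((n : ℝ) - 1) * t)
    (hβ : ∀ t, β t =
      ((n : ℝ) - 1) * t ^ 2 * (1 + ((n : ℝ) - 1) * t) * ((n : ℝ) + ((n : ℝ) - 1) * t) /
        ((1 - ((n : ℝ) - 1) * t) * (1 - t - ((n : ℝ) - 1) * t ^ 2)) *
      (1 + t * (1 + ((n : ℝ) - 1) * t) / (1 - 2 * t - 2 * ((n : ℝ) - 1) * t ^ 2)) ^ (n - 1))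
    (x0 : Fin n → K) (hx0 : Function.Injective x0)
    (hE0 : Einf f x0 ≤ 4 / (9 * (n : ℝ))) :
    (∃ ζ : Fin n → K, Function.Injective ζ ∧ IsRootVector f ζ) ∧
    (∀ k : ℕ, Function.Injective ((TnbE f)^[k] x0)) ∧
    (∃ ξ : Fin n → K, IsRootVector f ξ ∧
      Tendsto (fun k => (TnbE f)^[k] x0) atTop (nhds ξ)) ∧
    ∀ k : ℕ,
      (∀ i j : Fin n, i ≠ j →
        Disjoint
          (Metric.closedBall ((TnbE f)^[k] x0 i)
            (γ (Einf f ((TnbE f)^[k] x0)) / (1 - β (Einf f ((TnbE f)^[k] x0))) *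
              ‖Wc f ((TnbE f)^[k] x0) i‖))
          (Metric.closedBall ((TnbE f)^[k] x0 j)
            (γ (Einf f ((TnbE f)^[k] x0)) / (1 - β (Einf f ((TnbE f)^[k] x0))) *
              ‖Wc f ((TnbE f)^[k] x0) j‖))) ∧
      (∀ i : Fin n, ∃! z : K,
        z ∈ Metric.closedBall ((TnbE f)^[k] x0 i)
          (γ (Einf f ((TnbE f)^[k] x0)) / (1 - β (Einf f ((TnbE f)^[k] x0))) *
            ‖Wc f ((TnbE f)^[k] x0) i‖) ∧
        eval z f = 0) := by
  obtain ⟨ξ, hξ⟩ := exists_tendsto_TnbE_iterate hn hdeg hx0 hE0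
  have hspec := TnbE_iterate_spec hn hdeg hx0 hE0
  have hβ' : β = tanabeRate n := funext hβ
  have hmem : ∀ k i, ξ i ∈ Metric.closedBall ((TnbE f)^[k] x0 i)
      ((1 + ((n : ℝ) - 1) * Einf f ((TnbE f)^[k] x0)) /
        (1 - tanabeRate n (Einf f ((TnbE f)^[k] x0))) * ‖Wc f ((TnbE f)^[k] x0) i‖) := by
    intro k i
    refine mem_closedBall_of_tendsto hn hdeg (hspec k).1 ((hspec k).2.1.trans hE0) ?_
    simp only [← Function.iterate_add_apply]
    exact (tendsto_pi_nhds.1 hξ i).comp (tendsto_add_atTop_nat k)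
  have hdisj := fun k (i j : Fin n) (hij : i ≠ j) =>
    disjoint_closedBall hn (hspec k).1 ((hspec k).2.1.trans hE0) hij
  have hinj : Function.Injective ξ := fun i j h => by
    by_contra hij
    exact Set.disjoint_left.1 (hdisj 0 i j hij) (hmem 0 i) (h ▸ hmem 0 j)
  have hzero := eval_eq_zero_of_tendsto hn hdeg hx0 hE0 hξ
  have hroot := isRootVector_of_injective hdeg hinj hzero
  have hf : f ≠ 0 := by rintro rfl; simp at hdeg
  simp only [hβ', hγ]
  refine ⟨⟨ξ, hinj, hroot⟩, fun k => (hspec k).1, ⟨ξ, hroot, hξ⟩, fun k => ⟨hdisj k, fun i =>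
    ⟨ξ i, ⟨hmem k i, hzero i⟩, ?_⟩⟩⟩
  rintro z ⟨hz, hz0⟩
  rw [hroot, eval_mul, eval_C, eval_prod, mul_eq_zero, prod_eq_zero_iff] at hz0
  obtain ⟨j, -, hj⟩ := hz0.resolve_left (leadingCoeff_ne_zero.2 hf)
  rw [eval_sub, eval_X, eval_C, sub_eq_zero] at hj
  subst hj
  by_contra hne
  have hij : i ≠ j := fun h => hne (by rw [h])
  exact Set.disjoint_left.1 (hdisj k i j hij) hz (hmem k j)
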